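/- Let d ≥ 2 and let P ⊆ ℝ^d be a full-dimensional convex polytope. If P is edge-transitive but not vertex-transitive, then P is bipartite. -/

import Mathlib

open Set Pointwise

noncomputable section

/-- Euclidean space `ℝ^d`. -/
abbrev Euc (d : ℕ) := EuclideanSpace ℝ (Fin d)

/-- A convex polytope: the convex hull of a finite set of points. -/
def IsPolytope {d : ℕ} (P : Set (Euc d)) : Prop :=
  ∃ S : Finset (Euc d), P = convexHull ℝ (S : Set (Euc d))

/-- `P` is full-dimensional: its affine span is all of `ℝ^d`. -/
def FullDim {d : ℕ} (P : Set (Euc d)) : Prop :=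
  affineSpan ℝ P = ⊤

/-- `[v,w]` is an edge of `P`: an exposed face of `P` which is a segment with `v ≠ w`. -/
def IsEdge {d : ℕ} (P : Set (Euc d)) (v w : Euc d) : Prop :=
  v ≠ w ∧ IsExposed ℝ P (segment ℝ v w)

/-- `e` is an edge of `P`, as a set. -/
def IsEdgeSet {d : ℕ} (P e : Set (Euc d)) : Prop :=
  ∃ v w : Euc d, IsEdge P v w ∧ e = segment ℝ v w

/-- `T` is a symmetry of `P`: a linear isometry mapping `P` onto itself. -/
def IsAut {d : ℕ} (P : Set (Euc d)) (T : Euc d ≃ₗᵢ[ℝ] Euc d) : Prop :=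
  T '' P = P

/-- `P` is vertex-transitive: any vertex (extreme point) can be mapped onto any
other by a symmetry of `P`. -/
def VertexTransitive {d : ℕ} (P : Set (Euc d)) : Prop :=
  ∀ v ∈ Set.extremePoints ℝ P, ∀ w ∈ Set.extremePoints ℝ P,
    ∃ T : Euc d ≃ₗᵢ[ℝ] Euc d, IsAut P T ∧ T v = w

/-- `P` is edge-transitive: any edge can be mapped onto any other by a symmetry of `P`. -/
def EdgeTransitive {d : ℕ} (P : Set (Euc d)) : Prop :=
  ∀ e e' : Set (Euc d), IsEdgeSet P e → IsEdgeSet P e' →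
    ∃ T : Euc d ≃ₗᵢ[ℝ] Euc d, IsAut P T ∧ T '' e = e'

/-- `P` is bipartite with vertex partition `V1, V2`, radii `r1 ≤ r2` and edge length `ℓ`:
all edges have length `ℓ`, every edge joins `V1` to `V2`, where `V1 ⊔ V2` is a partition of
the vertex set, and vertices in `Vᵢ` have norm `rᵢ`. -/
def IsBipartiteWith {d : ℕ} (P V1 V2 : Set (Euc d)) (r1 r2 ℓ : ℝ) : Prop :=
  (0 < ℓ) ∧ (∀ v w : Euc d, IsEdge P v w → ‖v - w‖ = ℓ) ∧
  (V1 ∪ V2 = Set.extremePoints ℝ P) ∧ Disjoint V1 V2 ∧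
  (∀ v w : Euc d, IsEdge P v w → (v ∈ V1 ∧ w ∈ V2) ∨ (v ∈ V2 ∧ w ∈ V1)) ∧
  (0 < r1) ∧ (r1 ≤ r2) ∧ (∀ v ∈ V1, ‖v‖ = r1) ∧ (∀ v ∈ V2, ‖v‖ = r2)

/-- `P` is a bipartite polytope. -/
def IsBipartite {d : ℕ} (P : Set (Euc d)) : Prop :=
  ∃ (V1 V2 : Set (Euc d)) (r1 r2 ℓ : ℝ), IsBipartiteWith P V1 V2 r1 r2 ℓ

/-- `P` is a strictly bipartite polytope (`r1 < r2`). -/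
def IsStrictlyBipartite {d : ℕ} (P : Set (Euc d)) : Prop :=
  ∃ (V1 V2 : Set (Euc d)) (r1 r2 ℓ : ℝ), IsBipartiteWith P V1 V2 r1 r2 ℓ ∧ r1 < r2

theorem exists_strict_functional_of_mem_extremePoints {E : Type*} [NormedAddCommGroup E]
    [NormedSpace ℝ E] {S : Set E} (hS : S.Finite) {v : E}
    (hv : v ∈ extremePoints ℝ (convexHull ℝ S)) :
    ∃ g : StrongDual ℝ E, ∀ s ∈ S, s ≠ v → g s < g v := by
  have hv' := ((convex_convexHull ℝ S).mem_extremePoints_iff_mem_sdiff_convexHull_sdiff.1 hv).2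
  have hvS : v ∉ convexHull ℝ (S \ {v}) := fun h =>
    hv' (convexHull_mono (sdiff_subset_sdiff_left (subset_convexHull ℝ S)) h)
  obtain ⟨g, c, hg, hc⟩ := geometric_hahn_banach_closed_point (convex_convexHull ℝ (S \ {v}))
    ((hS.subset sdiff_subset).isClosed_convexHull ℝ) hvS
  exact ⟨g, fun s hs hsv => (hg s (subset_convexHull ℝ _ ⟨hs, hsv⟩)).trans hc⟩

theorem exists_mem_lt_of_mem_convexHull {E : Type*} [NormedAddCommGroup E]
    [NormedSpace ℝ E] {S : Set E} (f : StrongDual ℝ E) {u : E} {c : ℝ}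
    (hu : u ∈ convexHull ℝ S) (h : c < f u) : ∃ s ∈ S, c < f s := by
  by_contra! hcon
  exact absurd (convexHull_min (t := {x | f x ≤ c}) hcon
    (convex_halfSpace_le f.toLinearMap.isLinear c) hu) (not_le.2 h)

theorem exists_mem_extremePoints_lt {E : Type*} [NormedAddCommGroup E]
    [NormedSpace ℝ E] {K : Set E} (hK : IsCompact K) (hconv : Convex ℝ K)
    (f : StrongDual ℝ E) {u : E} {c : ℝ} (hu : u ∈ K) (h : c < f u) :
    ∃ x ∈ extremePoints ℝ K, c < f x := by
  by_contra! hcon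
  rw [← closure_convexHull_extremePoints hK hconv] at hu
  exact absurd (closure_minimal (convexHull_min (t := {x | f x ≤ c}) hcon
    (convex_halfSpace_le f.toLinearMap.isLinear c))
    (isClosed_le f.continuous continuous_const) hu) (not_le.2 h)

theorem convex_halfSpace_lt_union {E : Type*} [NormedAddCommGroup E] [NormedSpace ℝ E]
    {C : Set E} (hC : Convex ℝ C) (h : StrongDual ℝ E) {m : ℝ} (hCm : ∀ x ∈ C, h x = m) :
    Convex ℝ ({x | h x < m} ∪ C) := by
  have hle : ∀ x ∈ {x | h x < m} ∪ C, h x ≤ m := by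
    rintro x (hx | hx)
    · exact le_of_lt hx
    · exact (hCm x hx).le
  rw [convex_iff_forall_pos]
  intro x hx y hy a b ha hb hab
  have hx' := hle x hx
  have hy' := hle y hy
  have key : (h x < m ∨ h y < m) → a • x + b • y ∈ {x | h x < m} ∪ C := by
    intro hlt
    left
    have hm : m = a * m + b * m := by rw [← add_mul, hab, one_mul]
    simp only [mem_ofPred_eq, map_add, map_smul, smul_eq_mul]
    rw [hm]
    rcases hlt with hlt | hlt
    · exact add_lt_add_of_lt_of_le (mul_lt_mul_of_pos_left hlt ha)
        (mul_le_mul_of_nonneg_left hy' hb.le)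
    · exact add_lt_add_of_le_of_lt (mul_le_mul_of_nonneg_left hx' ha.le)
        (mul_lt_mul_of_pos_left hlt hb)
  rcases hx with hx | hx
  · exact key (.inl hx)
  rcases hy with hy | hy
  · exact key (.inr hy)
  · exact .inr (hC hx hy ha.le hb.le hab)

/-- A linear functional which is not maximal over a polytope at a vertex increases along some edge
at that vertex. -/
theorem IsPolytope.exists_isEdge_lt {d : ℕ} {P : Set (Euc d)} (hP : IsPolytope P) {v u : Euc d}
    (hv : v ∈ extremePoints ℝ P) (hu : u ∈ P) (f : StrongDual ℝ (Euc d)) (hfu : f v < f u) :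
    ∃ w, IsEdge P v w ∧ f v < f w := by
  classical
  obtain ⟨S, rfl⟩ := hP
  have hvS : v ∈ S := extremePoints_convexHull_subset hv
  obtain ⟨g, hg⟩ := exists_strict_functional_of_mem_extremePoints S.finite_toSet hv
  set q : Euc d → Euc d := fun s => (g v - g s)⁻¹ • (s - v) with hq
  have hδ : ∀ s ∈ S.erase v, 0 < g v - g s := fun s hs =>
    sub_pos.2 (hg s (Finset.mem_of_mem_erase hs) (Finset.ne_of_mem_erase hs))
  have hsub : ∀ s ∈ S.erase v, s - v = (g v - g s) • q s := fun s hs => by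
    rw [hq, smul_inv_smul₀ (hδ s hs).ne']
  obtain ⟨s₀, hs₀, hfs₀⟩ := exists_mem_lt_of_mem_convexHull f hu hfu
  have hs₀' : s₀ ∈ S.erase v := Finset.mem_erase.2 ⟨fun h => by simp [h] at hfs₀, hs₀⟩
  have hpos : 0 < f (q s₀) := by
    have := sub_pos.2 hfs₀
    simp only [hq, map_smul, map_sub, smul_eq_mul]
    exact mul_pos (inv_pos.2 (hδ s₀ hs₀')) this
  set Q : Finset (Euc d) := (S.erase v).image q with hQ
  obtain ⟨q₀, hq₀, hfq₀⟩ := exists_mem_extremePoints_lt (Q.finite_toSet.isCompact_convexHull ℝ)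
    (convex_convexHull ℝ _) f
    (subset_convexHull ℝ _ (Finset.mem_coe.2 (Finset.mem_image_of_mem q hs₀'))) hpos
  obtain ⟨k, hk⟩ := exists_strict_functional_of_mem_extremePoints Q.finite_toSet hq₀
  obtain ⟨s₁, hs₁, hqs₁⟩ := Finset.mem_image.1
    (Finset.mem_coe.1 (extremePoints_convexHull_subset hq₀))
  obtain ⟨w, hw, hmax⟩ := ((S.erase v).filter (q · = q₀)).exists_max_image (fun s => g v - g s)
    ⟨s₁, Finset.mem_filter.2 ⟨hs₁, hqs₁⟩⟩
  obtain ⟨hwS, hqw⟩ := Finset.mem_filter.1 hw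
  have hwv : w - v = (g v - g w) • q₀ := hqw ▸ hsub w hwS
  have hfw : f v < f w := by
    have := congrArg f hwv
    simp only [map_sub, map_smul, smul_eq_mul] at this
    have := mul_pos (hδ w hwS) hfq₀
    linarith
  refine ⟨w, ⟨(Finset.ne_of_mem_erase hwS).symm, fun _ => ?_⟩, hfw⟩
  set h : StrongDual ℝ (Euc d) := k + k q₀ • g with hh
  have hdiff : ∀ s ∈ S.erase v, h s - h v = (g v - g s) * (k (q s) - k q₀) := fun s hs => by
    have := congrArg k (hsub s hs)
    simp only [map_sub, map_smul, smul_eq_mul] at this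
    simp only [hh, add_apply, smul_apply, smul_eq_mul]
    linear_combination this
  have hhw : h w = h v := by
    have := hdiff w hwS
    rw [hqw, sub_self, mul_zero] at this
    linarith
  have hseg : ∀ x ∈ segment ℝ v w, h x = h v := by
    rintro x ⟨a, b, -, -, hab, rfl⟩
    rw [map_add, map_smul, map_smul, hhw, ← add_smul, hab, one_smul]
  have hcov : convexHull ℝ (S : Set (Euc d)) ⊆ {x | h x < h v} ∪ segment ℝ v w := by
    refine convexHull_min (fun s hs => ?_) (convex_halfSpace_lt_union (convex_segment v w) h hseg)
    by_cases hsv : s = v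
    · exact .inr (hsv ▸ left_mem_segment ℝ v w)
    have hs' : s ∈ S.erase v := Finset.mem_erase.2 ⟨hsv, hs⟩
    by_cases hqs : q s = q₀
    · right
      have h1 := hδ s hs'
      have h2 := hδ w hwS
      have h3 : g v - g s ≤ g v - g w := hmax s (Finset.mem_filter.2 ⟨hs', hqs⟩)
      rw [segment_eq_image']
      refine ⟨(g v - g s) / (g v - g w), ⟨by positivity, (div_le_one h2).2 h3⟩, ?_⟩
      have h4 := hsub s hs'
      rw [hqs] at h4
      simp only
      rw [hwv, smul_smul, div_mul_cancel₀ _ h2.ne', ← h4, add_sub_cancel]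
    · left
      have h1 := hdiff s hs'
      have h2 := hk (q s) (Finset.mem_coe.2 (Finset.mem_image_of_mem q hs')) hqs
      have h3 := mul_pos (hδ s hs') (sub_pos.2 h2)
      simp only [mem_ofPred_eq]
      linarith
  have hle : ∀ x ∈ convexHull ℝ (S : Set (Euc d)), h x ≤ h v := fun x hx => by
    rcases hcov hx with hx | hx
    · exact le_of_lt hx
    · exact (hseg x hx).le
  refine ⟨h, Subset.antisymm (fun x hx => ⟨?_, fun y hy => (hseg x hx).symm ▸ hle y hy⟩) ?_⟩
  · exact (convex_convexHull ℝ _).segment_subset (subset_convexHull ℝ _ hvS)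
      (subset_convexHull ℝ _ (Finset.mem_of_mem_erase hwS)) hx
  · rintro x ⟨hx, hxmax⟩
    exact (hcov hx).resolve_left (not_lt.2 (hxmax v (subset_convexHull ℝ _ hvS)))

theorem left_mem_extremePoints_segment {E : Type*} [NormedAddCommGroup E]
    [InnerProductSpace ℝ E] (v w : E) : v ∈ extremePoints ℝ (segment ℝ v w) := by
  refine exposedPoints_subset_extremePoints ⟨left_mem_segment ℝ v w, innerSL ℝ (v - w), ?_⟩
  intro y hy
  rw [segment_eq_image'] at hy
  obtain ⟨t, ht, rfl⟩ := hy
  have hin : inner ℝ (v - w) (w - v) = -(‖w - v‖ ^ 2) := by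
    rw [← neg_sub w v, inner_neg_left, real_inner_self_eq_norm_sq]
  simp only [innerSL_apply_apply, inner_add_right, inner_smul_right, hin]
  have hnn : 0 ≤ t * ‖w - v‖ ^ 2 := mul_nonneg ht.1 (sq_nonneg _)
  refine ⟨by linarith, fun hle => ?_⟩
  have hzero : t * ‖w - v‖ ^ 2 = 0 := by linarith
  rcases mul_eq_zero.1 hzero with h | h
  · simp [h]
  · simp [norm_eq_zero.1 (pow_eq_zero_iff two_ne_zero |>.1 h)]

theorem extremePoints_segment {E : Type*} [NormedAddCommGroup E]
    [InnerProductSpace ℝ E] (v w : E) : extremePoints ℝ (segment ℝ v w) = {v, w} := by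
  refine Subset.antisymm ?_ ?_
  · rw [← convexHull_pair]
    exact extremePoints_convexHull_subset
  · rintro x (rfl | rfl)
    · exact left_mem_extremePoints_segment _ _
    · rw [segment_symm]
      exact left_mem_extremePoints_segment _ _

theorem segment_eq_segment_iff {E : Type*} [NormedAddCommGroup E] [InnerProductSpace ℝ E]
    {v w x y : E} : segment ℝ v w = segment ℝ x y ↔ (v = x ∧ w = y) ∨ (v = y ∧ w = x) := by
  rw [← Set.pair_eq_pair_iff]
  refine ⟨fun h => ?_, fun h => ?_⟩
  · rw [← extremePoints_segment, h, extremePoints_segment]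
  · rw [← convexHull_pair, h, convexHull_pair]

theorem IsEdge.symm {d : ℕ} {P : Set (Euc d)} {v w : Euc d} (h : IsEdge P v w) :
    IsEdge P w v := ⟨h.1.symm, segment_symm ℝ v w ▸ h.2⟩

theorem IsEdge.left_mem_extremePoints {d : ℕ} {P : Set (Euc d)} {v w : Euc d}
    (h : IsEdge P v w) : v ∈ extremePoints ℝ P :=
  h.2.isExtreme.extremePoints_subset_extremePoints (left_mem_extremePoints_segment v w)

theorem EdgeTransitive.exists_isAut {d : ℕ} {P : Set (Euc d)} (hET : EdgeTransitive P)
    {v w x y : Euc d} (hvw : IsEdge P v w) (hxy : IsEdge P x y) :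
    ∃ T, IsAut P T ∧ ((T v = x ∧ T w = y) ∨ (T v = y ∧ T w = x)) := by
  obtain ⟨T, hT, hTe⟩ := hET _ _ ⟨v, w, hvw, rfl⟩ ⟨x, y, hxy, rfl⟩
  refine ⟨T, hT, segment_eq_segment_iff.1 ?_⟩
  rw [← hTe]
  exact (image_segment ℝ T.toLinearEquiv.toLinearMap.toAffineMap v w).symm

theorem IsAut.symm {d : ℕ} {P : Set (Euc d)} {T : Euc d ≃ₗᵢ[ℝ] Euc d} (hT : IsAut P T) :
    IsAut P T.symm := by
  have h : T.symm '' (T '' P) = P := by simp [image_image]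
  rwa [hT] at h

theorem IsAut.trans {d : ℕ} {P : Set (Euc d)} {T U : Euc d ≃ₗᵢ[ℝ] Euc d} (hT : IsAut P T)
    (hU : IsAut P U) : IsAut P (T.trans U) := by
  rw [IsAut, LinearIsometryEquiv.coe_trans, image_comp, hT, hU]

theorem exists_inner_eq_zero_inner_pos {d : ℕ} (hd : 2 ≤ d) {P : Set (Euc d)}
    (hfull : FullDim P) (b : Euc d) :
    ∃ c : Euc d, inner ℝ c b = 0 ∧ ∃ u ∈ P, 0 < inner ℝ c u := by
  obtain ⟨c, hc, hc0⟩ : ∃ c ∈ (ℝ ∙ b)ᗮ, c ≠ 0 := by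
    refine Submodule.exists_mem_ne_zero_of_ne_bot fun h => ?_
    have h1 := Submodule.finrank_add_finrank_orthogonal (ℝ ∙ b)
    have h2 := finrank_span_le_card (R := ℝ) ({b} : Set (Euc d))
    rw [h, finrank_bot, finrank_euclideanSpace_fin] at h1
    simp at h2
    omega
  have hcb : inner ℝ c b = 0 := by
    rw [real_inner_comm]
    exact Submodule.mem_orthogonal_singleton_iff_inner_right.1 hc
  obtain ⟨u, hu, hne⟩ : ∃ u ∈ P, inner ℝ c u ≠ 0 := by
    by_contra! hcon
    have hle : affineSpan ℝ P ≤ ((ℝ ∙ c)ᗮ).toAffineSubspace :=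
      affineSpan_le.2 fun u hu => Submodule.mem_orthogonal_singleton_iff_inner_right.2 (hcon u hu)
    rw [hfull] at hle
    have hcc : c ∈ (ℝ ∙ c)ᗮ := hle (AffineSubspace.mem_top ℝ _ c)
    exact hc0 (inner_self_eq_zero.1 (Submodule.mem_orthogonal_singleton_iff_inner_right.1 hcc))
  rcases hne.lt_or_gt with hlt | hgt
  · exact ⟨-c, by simp [hcb], u, hu, by simpa using hlt⟩
  · exact ⟨c, hcb, u, hu, hgt⟩

theorem IsEdge.left_ne_zero {d : ℕ} (hd : 2 ≤ d) {P : Set (Euc d)} (hP : IsPolytope P)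
    (hfull : FullDim P) (hET : EdgeTransitive P) {a b : Euc d} (hab : IsEdge P a b) : a ≠ 0 := by
  rintro rfl
  obtain ⟨c, hcb, u, hu, hcu⟩ := exists_inner_eq_zero_inner_pos hd hfull b
  obtain ⟨y, hby, hy⟩ := hP.exists_isEdge_lt hab.symm.left_mem_extremePoints hu (innerSL ℝ c)
    (by simpa [hcb] using hcu)
  obtain ⟨T, -, ⟨h, -⟩ | ⟨h, -⟩⟩ := hET.exists_isAut hab hby
  · exact hab.1 (by rw [← h, map_zero])
  · rw [map_zero] at h
    simp [← h, hcb] at hy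

/-- An edge-transitive polytope is bipartite if an edge joins vertices from two different orbits,
which cover all vertices. -/
theorem EdgeTransitive.isBipartite_of_isEdge {d : ℕ} {P : Set (Euc d)} (hET : EdgeTransitive P)
    {a b : Euc d} (hab : IsEdge P a b) (ha : a ≠ 0) (hle : ‖a‖ ≤ ‖b‖)
    (hne : ¬ ∃ T, IsAut P T ∧ T a = b)
    (hcover : ∀ x ∈ extremePoints ℝ P, ∃ y, IsEdge P x y) : IsBipartite P := by
  have hmem : ∀ {x}, x ∈ extremePoints ℝ P → ∀ T, IsAut P T → T x ∈ extremePoints ℝ P := by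
    intro x hx T hT
    have := image_extremePoints (𝕜 := ℝ) T P
    rw [hT] at this
    exact this ▸ mem_image_of_mem T hx
  refine ⟨{x | ∃ T, IsAut P T ∧ T a = x}, {x | ∃ T, IsAut P T ∧ T b = x}, ‖a‖, ‖b‖, ‖a - b‖,
    norm_pos_iff.2 (sub_ne_zero.2 hab.1), ?_, ?_, ?_, ?_, norm_pos_iff.2 ha, hle, ?_, ?_⟩
  · intro v w hvw
    obtain ⟨T, -, ⟨rfl, rfl⟩ | ⟨rfl, rfl⟩⟩ := hET.exists_isAut hab hvw
    · rw [← map_sub, T.norm_map]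
    · rw [← map_sub, T.norm_map, norm_sub_rev]
  · refine Subset.antisymm ?_ fun x hx => ?_
    · rintro x (⟨T, hT, rfl⟩ | ⟨T, hT, rfl⟩)
      · exact hmem hab.left_mem_extremePoints T hT
      · exact hmem hab.symm.left_mem_extremePoints T hT
    · obtain ⟨y, hxy⟩ := hcover x hx
      obtain ⟨T, hT, ⟨h, -⟩ | ⟨-, h⟩⟩ := hET.exists_isAut hab hxy
      · exact .inl ⟨T, hT, h⟩
      · exact .inr ⟨T, hT, h⟩
  · rw [disjoint_left]
    rintro x ⟨T, hT, rfl⟩ ⟨U, hU, h⟩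
    exact hne ⟨T.trans U.symm, hT.trans hU.symm, by simp [← h]⟩
  · intro v w hvw
    obtain ⟨T, hT, ⟨h1, h2⟩ | ⟨h1, h2⟩⟩ := hET.exists_isAut hab hvw
    · exact .inl ⟨⟨T, hT, h1⟩, ⟨T, hT, h2⟩⟩
    · exact .inr ⟨⟨T, hT, h2⟩, ⟨T, hT, h1⟩⟩
  · rintro v ⟨T, -, rfl⟩
    exact T.norm_map a
  · rintro v ⟨T, -, rfl⟩
    exact T.norm_map b

/-- In dimension `d ≥ 2`, every full-dimensional convex polytope that is
edge-transitive but not vertex-transitive is bipartite. -/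
theorem edge_not_vertex_transitive_is_bipartite {d : ℕ} (hd : 2 ≤ d)
    (P : Set (Euc d)) (hP : IsPolytope P) (hfull : FullDim P)
    (hET : EdgeTransitive P) (hVT : ¬ VertexTransitive P) : IsBipartite P := by
  have hcover : ∀ x ∈ extremePoints ℝ P, ∃ y, IsEdge P x y := by
    intro x hx
    obtain ⟨c, hcx, u, hu, hcu⟩ := exists_inner_eq_zero_inner_pos hd hfull x
    obtain ⟨y, hxy, -⟩ := hP.exists_isEdge_lt hx hu (innerSL ℝ c) (by simpa [hcx] using hcu)
    exact ⟨y, hxy⟩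
  simp only [VertexTransitive, not_forall] at hVT
  obtain ⟨v, hv, w, hw, hvw⟩ := hVT
  obtain ⟨b, hvb⟩ := hcover v hv
  obtain ⟨c, hwc⟩ := hcover w hw
  have hne : ¬ ∃ T, IsAut P T ∧ T v = b := by
    rintro ⟨T, hT, hTb⟩
    obtain ⟨U, hU, ⟨h, -⟩ | ⟨-, h⟩⟩ := hET.exists_isAut hvb hwc
    · exact hvw ⟨U, hU, h⟩
    · exact hvw ⟨T.trans U, hT.trans hU, by simp [hTb, h]⟩
  rcases le_total ‖v‖ ‖b‖ with hle | hle
  · exact hET.isBipartite_of_isEdge hvb (hvb.left_ne_zero hd hP hfull hET) hle hne hcover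
  · refine hET.isBipartite_of_isEdge hvb.symm (hvb.symm.left_ne_zero hd hP hfull hET) hle ?_ hcover
    rintro ⟨T, hT, h⟩
    exact hne ⟨T.symm, hT.symm, by simp [← h]⟩
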